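/- arXiv:1106.0769 — 2 statements merged into one kernel-verified Lean document; each statement's English description precedes it below -/
import Mathlib

section
/- Let G be a finite simple (unweighted) graph on n vertices and let 2 ≤ m ≤ n. Then d_m(G) − n + m ≤ λ_m(G) ≤ d_{m−1}(G) + m − 1, where λ_m(G) is the m-th smallest Laplacian eigenvalue of G and d_i(G) is the i-th smallest vertex degree of G. -/
open Matrix Finset

theorem exists_perm_of_map_eq {n : ℕ} {α : Type*} [LinearOrder α] (f g : Fin n → α)
    (hf : Monotone f) (h : Finset.univ.val.map f = Finset.univ.val.map g) :
    ∃ σ : Equiv.Perm (Fin n), f = g ∘ σ := by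
  refine ⟨Tuple.sort g, ?_⟩
  rw [Fin.univ_val_map, Fin.univ_val_map, Multiset.coe_eq_coe] at h
  exact List.ofFn_injective <|
    (h.trans ((Tuple.sort g).ofFn_comp_perm g).symm).eq_of_pairwise'
      hf.sortedLE_ofFn.pairwise (Tuple.monotone_sort g).sortedLE_ofFn.pairwise

theorem exists_eigen_coords {n : ℕ} (A : Matrix (Fin n) (Fin n) ℝ) (hA : A.IsHermitian)
    (eigs : Fin n → ℝ) (heigs : Monotone eigs) (hroots : A.charpoly.roots = Finset.univ.val.map eigs) :
    ∃ b : Fin n → Fin n → ℝ, ∀ x : Fin n → ℝ,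
      x ⬝ᵥ x = ∑ j, (b j ⬝ᵥ x) ^ 2 ∧ x ⬝ᵥ (A *ᵥ x) = ∑ j, eigs j * (b j ⬝ᵥ x) ^ 2 := by
  have h1 := hA.roots_charpoly_eq_eigenvalues
  rw [hroots] at h1
  obtain ⟨σ, hσ⟩ : ∃ σ : Equiv.Perm (Fin n), eigs = hA.eigenvalues ∘ σ :=
    exists_perm_of_map_eq _ _ heigs h1
  have hsum : ∀ x : Fin n → ℝ, ∀ j, inner ℝ (hA.eigenvectorBasis j) (WithLp.toLp 2 x)
      = (fun i => hA.eigenvectorBasis j i) ⬝ᵥ x := by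
    intro x j
    simp [PiLp.inner_apply, dotProduct, mul_comm]
  refine ⟨fun j => fun i => hA.eigenvectorBasis (σ j) i, fun x => ⟨?_, ?_⟩⟩
  · have := hA.eigenvectorBasis.sum_inner_mul_inner (WithLp.toLp 2 x) (WithLp.toLp 2 x)
    have h2 : inner ℝ (WithLp.toLp 2 x) (WithLp.toLp 2 x) = x ⬝ᵥ x := by
      simp only [PiLp.inner_apply, dotProduct]; rfl
    rw [← h2, ← this, ← Equiv.sum_comp σ]
    refine Finset.sum_congr rfl fun j _ => ?_
    rw [← hsum, real_inner_comm, sq]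
  · have := hA.eigenvectorBasis.sum_inner_mul_inner (WithLp.toLp 2 x) (WithLp.toLp 2 (A *ᵥ x))
    have h2 : inner ℝ (WithLp.toLp 2 x) (WithLp.toLp 2 (A *ᵥ x)) = x ⬝ᵥ (A *ᵥ x) := by
      simp [PiLp.inner_apply, dotProduct, mul_comm]
    rw [← h2, ← this, ← Equiv.sum_comp σ]
    refine Finset.sum_congr rfl fun j _ => ?_
    have h3 := hA.mulVec_eigenvectorBasis (σ j)
    have hT : Aᵀ = A := by
      have : A.IsSymm := by simpa using hA
      exact this
    have h4 : (fun i => hA.eigenvectorBasis (σ j) i) ⬝ᵥ (A *ᵥ x)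
       = eigs j * ((fun i => hA.eigenvectorBasis (σ j) i) ⬝ᵥ x) := by
      rw [dotProduct_mulVec, ← mulVec_transpose, hT]
      have : A *ᵥ (fun i => hA.eigenvectorBasis (σ j) i) = eigs j • (fun i => hA.eigenvectorBasis (σ j) i) := by
        rw [hσ]; exact h3
      rw [this, smul_dotProduct, smul_eq_mul]
    rw [hsum, h4, real_inner_comm, hsum]
    ring

theorem lap_quad {n : ℕ} (G : SimpleGraph (Fin n)) [DecidableRel G.Adj] (x : Fin n → ℝ) :
    x ⬝ᵥ (G.lapMatrix ℝ *ᵥ x) = (∑ i, ∑ j, if G.Adj i j then (x i - x j) ^ 2 else 0) / 2 := by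
  rw [← G.lapMatrix_toLinearMap₂' (R := ℝ) x, Matrix.toLinearMap₂'_apply']

theorem sum_sq_diff {n : ℕ} (x : Fin n → ℝ) :
    ∑ i, ∑ j, (x i - x j) ^ 2 = 2 * (n * ∑ i, x i ^ 2 - (∑ i, x i) ^ 2) := by
  simp only [sub_sq, Finset.sum_add_distrib, Finset.sum_sub_distrib, Finset.sum_const, Finset.card_univ,
    Fintype.card_fin, nsmul_eq_mul, ← Finset.mul_sum, ← Finset.sum_mul, mul_assoc]
  ring

theorem quad_le {n : ℕ} (G : SimpleGraph (Fin n)) [DecidableRel G.Adj] (S : Finset (Fin n))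
    (D : ℝ) (hD : ∀ v ∈ S, (G.degree v : ℝ) ≤ D) (y : Fin n → ℝ) (hy : ∀ v, v ∉ S → y v = 0) :
    (∑ i, ∑ j, if G.Adj i j then (y i - y j) ^ 2 else 0) / 2 ≤
      (D + S.card) * ∑ i, y i ^ 2 - (∑ i, y i) ^ 2 := by
  have key : ∀ i j, (if G.Adj i j then (y i - y j) ^ 2 else 0) ≤
      ((if j ∈ S then 1 else 0) * y i ^ 2 + (if i ∈ S then 1 else 0) * y j ^ 2 - 2 * (y i * y j))
       + ((if G.Adj i j then 1 else 0) * y i ^ 2 + (if G.Adj j i then 1 else 0) * y j ^ 2) := by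
    intro i j
    have hc := G.adj_comm j i
    by_cases hi : i ∈ S <;> by_cases hj : j ∈ S <;> by_cases ha : G.Adj i j <;>
      simp [hi, hj, ha, hc, hy] <;> nlinarith [sq_nonneg (y i - y j), sq_nonneg (y i), sq_nonneg (y j)]
  have h1 := Finset.sum_le_sum fun i (_ : i ∈ univ) => Finset.sum_le_sum fun j (_ : j ∈ univ) => key i j
  have hdeg : ∀ i, ∑ j, (if G.Adj i j then (1 : ℝ) else 0) = G.degree i := fun i =>
    (G.degree_eq_sum_if_adj (R := ℝ) i).symm
  have hS : ∑ j, (if j ∈ S then (1 : ℝ) else 0) = S.card := by simp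
  have e1 : ∑ i, ∑ j, (if j ∈ S then (1:ℝ) else 0) * y i ^ 2 = S.card * ∑ i, y i ^ 2 := by
    simp only [← Finset.sum_mul, hS, ← Finset.mul_sum]
  have e2 : ∑ i, ∑ j, (if i ∈ S then (1:ℝ) else 0) * y j ^ 2 = S.card * ∑ i, y i ^ 2 := by
    rw [Finset.sum_comm, e1]
  have e3 : ∑ i, ∑ j, 2 * (y i * y j) = 2 * (∑ i, y i) ^ 2 := by
    simp only [← Finset.mul_sum, ← Finset.sum_mul]; ring
  have e4 : ∑ i, ∑ j, (if G.Adj i j then (1:ℝ) else 0) * y i ^ 2 = ∑ i, G.degree i * y i ^ 2 := by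
    simp only [← Finset.sum_mul, hdeg]
  have e5 : ∑ i, ∑ j, (if G.Adj j i then (1:ℝ) else 0) * y j ^ 2 = ∑ i, G.degree i * y i ^ 2 := by
    rw [Finset.sum_comm, e4]
  simp only [Finset.sum_add_distrib, Finset.sum_sub_distrib] at h1
  rw [e1, e2, e3, e4, e5] at h1
  have h6 : ∑ i, (G.degree i : ℝ) * y i ^ 2 ≤ D * ∑ i, y i ^ 2 := by
    rw [Finset.mul_sum]
    refine Finset.sum_le_sum fun i _ => ?_
    by_cases hi : i ∈ S
    · exact mul_le_mul_of_nonneg_right (hD i hi) (sq_nonneg _)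
    · simp [hy i hi]
  linarith

theorem quad_compl {n : ℕ} (G : SimpleGraph (Fin n)) [DecidableRel G.Adj] (y : Fin n → ℝ) :
    (∑ i, ∑ j, if G.Adj i j then (y i - y j) ^ 2 else 0) / 2 +
    (∑ i, ∑ j, if Gᶜ.Adj i j then (y i - y j) ^ 2 else 0) / 2 =
     n * ∑ i, y i ^ 2 - (∑ i, y i) ^ 2 := by
  have : ∑ i, ∑ j, (y i - y j) ^ 2 = (∑ i, ∑ j, if G.Adj i j then (y i - y j) ^ 2 else 0) +
    (∑ i, ∑ j, if Gᶜ.Adj i j then (y i - y j) ^ 2 else 0) := by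
    simp only [← Finset.sum_add_distrib]
    refine Finset.sum_congr rfl fun i _ => Finset.sum_congr rfl fun j _ => ?_
    by_cases h : i = j
    · subst h; simp
    · by_cases ha : G.Adj i j <;> simp [ha, h]
  rw [sum_sq_diff] at this
  linarith

/-- Nonzero solution of a system of `n` equations in `n + 1` unknowns. -/
theorem exists_sol {n : ℕ} (f : ((Fin n → ℝ) × ℝ) →ₗ[ℝ] (Fin n → ℝ)) :
    ∃ p : (Fin n → ℝ) × ℝ, p ≠ 0 ∧ f p = 0 := by
  have h : LinearMap.ker f ≠ ⊥ := LinearMap.ker_ne_bot_of_finrank_lt (by simp)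
  obtain ⟨p, hp, h0⟩ := (Submodule.ne_bot_iff _).1 h
  exact ⟨p, h0, hp⟩

theorem shift_sq {n : ℕ} (y : Fin n → ℝ) (c : ℝ) :
    ∑ i, (y i + c) ^ 2 = ∑ i, y i ^ 2 + 2 * c * ∑ i, y i + n * c ^ 2 := by
  simp only [add_sq, Finset.sum_add_distrib, Finset.mul_sum]
  simp
  refine Finset.sum_congr rfl fun i _ => by ring

/-- For a functional `l`, the composite `(y, c) ↦ l · (y + c 1)`. -/
noncomputable def shiftFun {n : ℕ} (l : Fin n → ℝ) : ((Fin n → ℝ) × ℝ) →ₗ[ℝ] ℝ where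
  toFun p := l ⬝ᵥ (fun i => p.1 i + p.2)
  map_add' p q := by
    simp only [dotProduct, ← Finset.sum_add_distrib]
    exact Finset.sum_congr rfl fun i _ => by simp; ring
  map_smul' a p := by
    simp only [dotProduct, smul_eq_mul, Finset.mul_sum]
    exact Finset.sum_congr rfl fun i _ => by simp; ring

theorem lap_eigenvalue_weak_two_sided_bound (n m : ℕ) (hm : 2 ≤ m) (hmn : m ≤ n)
    (G : SimpleGraph (Fin n)) [DecidableRel G.Adj]
    (eigs : Fin n → ℝ) (heigs : Monotone eigs)
    (hroots : (G.lapMatrix ℝ).charpoly.roots = Finset.univ.val.map eigs)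
    (d : Fin n → ℕ) (hd : Monotone d)
    (hdeg : Finset.univ.val.map d = Finset.univ.val.map (fun v => G.degree v)) :
    (d ⟨m - 1, by omega⟩ : ℝ) - n + m ≤ eigs ⟨m - 1, by omega⟩ ∧
      eigs ⟨m - 1, by omega⟩ ≤ (d ⟨m - 2, by omega⟩ : ℝ) + m - 1 := by
  obtain ⟨b, hb⟩ := exists_eigen_coords _ (G.isHermitian_lapMatrix ℝ) eigs heigs hroots
  obtain ⟨σ, hσ⟩ : ∃ σ : Equiv.Perm (Fin n), d = (fun v => G.degree v) ∘ σ :=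
    exists_perm_of_map_eq _ _ hd hdeg
  have hdσ : ∀ p, G.degree (σ p) = d p := fun p => by rw [hσ]; rfl
  have hn0 : (0:ℝ) < n := by exact_mod_cast (by omega : 0 < n)
  set k : Fin n := ⟨m - 1, by omega⟩ with hk
  have hkm : ((k : ℕ) : ℝ) = m - 1 := by
    rw [hk]; push_cast [Nat.cast_sub (by omega : 1 ≤ m)]; ring
  have hnorm : ∀ x : Fin n → ℝ, x ⬝ᵥ x = ∑ i, x i ^ 2 := fun x => by simp [dotProduct, sq]
  -- quadratic form at a shifted vector
  have hq : ∀ (y : Fin n → ℝ) (c : ℝ), ∑ j, eigs j * (b j ⬝ᵥ (fun i => y i + c)) ^ 2 =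
      (∑ i, ∑ j, if G.Adj i j then (y i - y j) ^ 2 else 0) / 2 := by
    intro y c
    rw [← (hb _).2, lap_quad]
    simp
  have hqn : ∀ y : Fin n → ℝ, 0 ≤ (∑ i, ∑ j, if G.Adj i j then (y i - y j) ^ 2 else 0) / 2 := by
    intro y
    refine div_nonneg (Finset.sum_nonneg fun i _ => Finset.sum_nonneg fun j _ => ?_) (by norm_num)
    split_ifs <;> positivity
  have hpos : ∀ (y : Fin n → ℝ) (c : ℝ) (v : Fin n), (y, c) ≠ 0 → y v = 0 →
      0 < ∑ i, (y i + c) ^ 2 := by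
    intro y c v hne hv
    rcases (Finset.sum_nonneg fun i (_ : i ∈ univ) => sq_nonneg (y i + c)).lt_or_eq with h | h
    · exact h
    · exfalso
      have h0 := (Finset.sum_eq_zero_iff_of_nonneg fun i (_ : i ∈ univ) => sq_nonneg (y i + c)).1 h.symm
      have h1 : ∀ i, y i + c = 0 := fun i => by simpa using h0 i (mem_univ i)
      have hc : c = 0 := by simpa [hv] using h1 v
      apply hne
      ext i
      · simpa [hc] using h1 i
      · exact hc
  constructor
  · -- lower bound
    obtain ⟨⟨y, c⟩, hne, hf⟩ := exists_sol (LinearMap.pi fun p : Fin n =>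
      if p < k then (LinearMap.proj (σ p)).comp (LinearMap.fst ℝ (Fin n → ℝ) ℝ)
      else if p = k then shiftFun (fun _ => 1) else shiftFun (b p))
    have h1 : ∀ p, p < k → y (σ p) = 0 := fun p hp => by
      simpa [hp] using congrFun hf p
    have h2 : ∀ p, k < p → b p ⬝ᵥ (fun i => y i + c) = 0 := fun p hp => by
      simpa [hp.not_gt, hp.ne', shiftFun] using congrFun hf p
    have h3 : ∑ i, y i + n * c = 0 := by
      simpa [shiftFun, dotProduct, Finset.sum_add_distrib] using congrFun hf k
    have hN := hpos y c (σ ⟨0, by omega⟩) hne (h1 _ (by simp [hk, Fin.lt_def]; omega))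
    have hle : (∑ i, ∑ j, if G.Adj i j then (y i - y j) ^ 2 else 0) / 2 ≤
        eigs k * ∑ i, (y i + c) ^ 2 := by
      rw [← hq y c, ← hnorm (fun i => y i + c), (hb _).1, Finset.mul_sum]
      refine Finset.sum_le_sum fun p _ => ?_
      rcases le_or_gt p k with hp | hp
      · exact mul_le_mul_of_nonneg_right (heigs hp) (sq_nonneg _)
      · simp [h2 p hp]
    have hcard : (((Finset.Ici k).map σ.toEmbedding).card : ℝ) = n - (m - 1) := by
      rw [Finset.card_map, Fin.card_Ici, Nat.cast_sub k.2.le, hkm]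
    have hge := quad_le Gᶜ ((Finset.Ici k).map σ.toEmbedding) (n - 1 - d k) (by
      intro v hv
      obtain ⟨p, hp, rfl⟩ := Finset.mem_map.1 hv
      have hp : k ≤ p := by simpa using hp
      have h5 := G.degree_compl (v := σ p)
      have h6 := G.degree_lt_card_verts (σ p)
      have h7 := hd hp
      rw [hdσ] at h5 h6
      simp only [Fintype.card_fin] at h5 h6
      have : Gᶜ.degree (σ p) + d k + 1 ≤ n := by omega
      have : ((Gᶜ.degree (σ p) + d k + 1 : ℕ) : ℝ) ≤ n := by exact_mod_cast this
      push_cast at this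
      simp only [Equiv.coe_toEmbedding]
      linarith) y (by
      intro v hv
      have := h1 (σ.symm v) (by
        by_contra hlt
        exact hv (Finset.mem_map.2 ⟨σ.symm v, by simpa using hlt, by simp⟩))
      simpa using this)
    have hco := quad_compl G y
    rw [hcard] at hge
    have hsh := shift_sq y c
    have hq0 := hqn y
    set N := ∑ i, (y i + c) ^ 2
    set Y := ∑ i, y i ^ 2
    set s := ∑ i, y i
    by_contra! hcon
    have hs : s = - (n * c) := by linarith
    have hN2 : N = Y - n * c ^ 2 := by rw [hsh, hs]; ring
    have hE0 : 0 ≤ eigs k := by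
      by_contra! h; nlinarith
    have hY : Y = N + n * c ^ 2 := by linarith
    have hlow : ((d k : ℝ) - n + m) * Y ≤ eigs k * N := by nlinarith
    nlinarith [mul_nonneg hn0.le (sq_nonneg c), mul_pos (sub_pos.2 hcon) hN,
      mul_nonneg (hE0.trans hcon.le) (mul_nonneg hn0.le (sq_nonneg c))]
  · -- upper bound
    obtain ⟨⟨y, c⟩, hne, hf⟩ := exists_sol (LinearMap.pi fun p : Fin n =>
      if p < k then shiftFun (b p)
      else (LinearMap.proj (σ p)).comp (LinearMap.fst ℝ (Fin n → ℝ) ℝ))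
    have h1 : ∀ p, k ≤ p → y (σ p) = 0 := fun p hp => by
      simpa [hp.not_gt] using congrFun hf p
    have h2 : ∀ p, p < k → b p ⬝ᵥ (fun i => y i + c) = 0 := fun p hp => by
      simpa [hp, shiftFun] using congrFun hf p
    have hN := hpos y c (σ k) hne (h1 _ le_rfl)
    have hle : eigs k * ∑ i, (y i + c) ^ 2 ≤
        (∑ i, ∑ j, if G.Adj i j then (y i - y j) ^ 2 else 0) / 2 := by
      rw [← hq y c, ← hnorm (fun i => y i + c), (hb _).1, Finset.mul_sum]
      refine Finset.sum_le_sum fun p _ => ?_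
      rcases le_or_gt k p with hp | hp
      · exact mul_le_mul_of_nonneg_right (heigs hp) (sq_nonneg _)
      · simp [h2 p hp]
    have hcard : (((Finset.Iio k).map σ.toEmbedding).card : ℝ) = m - 1 := by
      rw [Finset.card_map, Fin.card_Iio, hkm]
    set e : Fin n := ⟨m - 2, by omega⟩ with he
    have hge := quad_le G ((Finset.Iio k).map σ.toEmbedding) (d e) (by
      intro v hv
      obtain ⟨p, hp, rfl⟩ := Finset.mem_map.1 hv
      have hp : p < k := by simpa using hp
      have hp : p ≤ e := by
        rw [Fin.le_def]; rw [Fin.lt_def] at hp; simp only [hk, he] at hp ⊢; omega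
      have h7 := hd hp
      simp only [Equiv.coe_toEmbedding]
      rw [hdσ]
      exact_mod_cast h7) y (by
      intro v hv
      have := h1 (σ.symm v) (by
        by_contra hlt
        exact hv (Finset.mem_map.2 ⟨σ.symm v, by simpa using hlt, by simp⟩))
      simpa using this)
    have hco := quad_compl G y
    have hco2 : 0 ≤ (∑ i, ∑ j, if Gᶜ.Adj i j then (y i - y j) ^ 2 else 0) / 2 := by
      refine div_nonneg (Finset.sum_nonneg fun i _ => Finset.sum_nonneg fun j _ => ?_) (by norm_num)
      split_ifs <;> positivity
    rw [hcard] at hge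
    have hsh := shift_sq y c
    set N := ∑ i, (y i + c) ^ 2
    set Y := ∑ i, y i ^ 2
    set s := ∑ i, y i
    set Q := (∑ i, ∑ j, if G.Adj i j then (y i - y j) ^ 2 else 0) / 2
    have hC0 : (0:ℝ) ≤ d e + m - 1 := by
      have : (2:ℝ) ≤ m := by exact_mod_cast hm
      have : (0:ℝ) ≤ d e := Nat.cast_nonneg _
      linarith
    have hNn : n * N = n * Y - s ^ 2 + (s + n * c) ^ 2 := by rw [hsh]; ring
    set C := (d e : ℝ) + m - 1
    have hge' : Q ≤ C * Y - s ^ 2 := by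
      have : (d e : ℝ) + (m - 1) = C := by simp only [C]; ring
      rwa [this] at hge
    have hQn : Q ≤ n * N := by nlinarith [sq_nonneg (s + n * c)]
    refine le_of_mul_le_mul_right (hle.trans ?_) hN
    rcases le_total (n:ℝ) C with h | h
    · exact hQn.trans (mul_le_mul_of_nonneg_right h hN.le)
    · refine le_of_mul_le_mul_left ?_ hn0
      have a1 : n * Q ≤ n * (C * Y - s ^ 2) := mul_le_mul_of_nonneg_left hge' hn0.le
      have a2 : C * (n * Y - s ^ 2) ≤ C * (n * N) :=
        mul_le_mul_of_nonneg_left (by nlinarith [sq_nonneg (s + n * c)]) hC0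
      have a3 : C * s ^ 2 ≤ n * s ^ 2 := mul_le_mul_of_nonneg_right h (sq_nonneg s)
      linarith
end

section
/- Let G be a finite simple graph on n ≥ 3 vertices that is not the disjoint union K_3 + (n−3)K_1 of a triangle with n−3 isolated vertices. Then the third largest Laplacian eigenvalue satisfies λ_{n−2}(G) ≥ d_{n−2}(G) − 1, where d_{n−2}(G) is the third largest vertex degree of G. -/
/-- `G` is (up to relabeling of vertices) the disjoint union of a complete graph on the
`r` vertices of a set `S` with the remaining vertices isolated. -/
def IsCliquePlusIsolated {V : Type*} [Fintype V] (G : SimpleGraph V) (r : ℕ) : Prop :=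
  ∃ S : Finset V, S.card = r ∧ ∀ u v : V, G.Adj u v ↔ u ≠ v ∧ u ∈ S ∧ v ∈ S


open Finset Matrix

lemma idx_lt {n : ℕ} (hn : 3 ≤ n) : n - 3 < n := by omega

lemma minmax3 {n : ℕ} (hn : 3 ≤ n) (A : Matrix (Fin n) (Fin n) ℝ) (hA : A.IsHermitian)
    (eigs : Fin n → ℝ) (heigs : Monotone eigs)
    (hroots : A.charpoly.roots = Finset.univ.val.map eigs) (θ : ℝ)
    (T : (Fin 3 → ℝ) →ₗ[ℝ] (Fin n → ℝ)) (hT : ∀ x, T x = 0 → x = 0)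
    (hQ : ∀ x, θ * ∑ i, (T x i)^2 ≤ T x ⬝ᵥ A *ᵥ T x) :
    θ ≤ eigs ⟨n - 3, idx_lt hn⟩ := by
  by_contra! hlt
  have hm : Finset.univ.val.map hA.eigenvalues = Finset.univ.val.map eigs := by
    rw [← hroots, hA.roots_charpoly_eq_eigenvalues]; rfl
  have hcount : #{i | eigs i < θ} = #{i | hA.eigenvalues i < θ} := by
    have := congrArg (Multiset.countP (fun t => t < θ)) hm
    rw [Multiset.countP_map, Multiset.countP_map] at this
    exact this.symm
  have hge : n - 2 ≤ #{i | eigs i < θ} := by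
    have : (Finset.Iic (⟨n - 3, idx_lt hn⟩ : Fin n)) ⊆ ({i | eigs i < θ} : Finset (Fin n)) := by
      intro i hi
      simp only [Finset.mem_Iic] at hi
      simp only [Finset.mem_filter, Finset.mem_univ, true_and]
      exact (heigs hi).trans_lt hlt
    have h2 := Finset.card_le_card this
    rw [Fin.card_Iic] at h2
    simp only at h2
    omega
  have hle : #{i | ¬ hA.eigenvalues i < θ} ≤ 2 := by
    have := Finset.card_filter_add_card_filter_not (s := (Finset.univ : Finset (Fin n))) (fun i => hA.eigenvalues i < θ)
    simp only [Finset.card_univ, Fintype.card_fin] at this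
    omega
  let b := hA.eigenvectorBasis
  -- coordinates
  let F : (Fin 3 → ℝ) →ₗ[ℝ] ({i // ¬ hA.eigenvalues i < θ} → ℝ) :=
    LinearMap.pi (fun i => (dotProductBilin ℝ ℝ (b i.1 : Fin n → ℝ)).comp T)
  obtain ⟨x, hxF, hx0⟩ : ∃ x, F x = 0 ∧ x ≠ 0 := by
    have : ¬ Function.Injective F := by
      intro hinj
      have := LinearMap.finrank_le_finrank_of_injective hinj
      simp only [Module.finrank_fintype_fun_eq_card, Fintype.card_subtype, Fintype.card_fin] at this
      omega
    rw [← LinearMap.ker_eq_bot, Submodule.eq_bot_iff] at this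
    push Not at this
    obtain ⟨x, h1, h2⟩ := this
    exact ⟨x, h1, h2⟩
  set z := T x with hz
  let Z : EuclideanSpace ℝ (Fin n) := WithLp.toLp 2 z
  have hc : ∀ i, b.repr Z i = (b i : Fin n → ℝ) ⬝ᵥ z := by
    intro i
    rw [b.repr_apply_apply, EuclideanSpace.inner_eq_star_dotProduct]
    simp [Z, dotProduct_comm]
  have hnorm : ∑ i, (z i)^2 = ∑ i, (b.repr Z i)^2 := by
    have h1 : ‖Z‖^2 = ∑ i, (z i)^2 := by
      rw [EuclideanSpace.real_norm_sq_eq]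
    have h2 : ‖b.repr Z‖^2 = ∑ i, (b.repr Z i)^2 := by
      rw [EuclideanSpace.real_norm_sq_eq]
    rw [← h1, ← h2, LinearIsometryEquiv.norm_map]
  have hE : z ⬝ᵥ A *ᵥ z = ∑ i, hA.eigenvalues i * (b.repr Z i)^2 := by
    have h1 : z ⬝ᵥ A *ᵥ z = inner ℝ Z (WithLp.toLp 2 (A *ᵥ z)) := by
      rw [EuclideanSpace.inner_eq_star_dotProduct]
      simp [Z, dotProduct_comm]
    rw [h1, ← b.sum_inner_mul_inner]
    refine Finset.sum_congr rfl fun i _ => ?_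
    have h2 : inner ℝ Z (b i) = b.repr Z i := by
      rw [b.repr_apply_apply, real_inner_comm]
    have h3 : inner ℝ (b i) (WithLp.toLp 2 (A *ᵥ z)) = hA.eigenvalues i * b.repr Z i := by
      rw [hc, EuclideanSpace.inner_eq_star_dotProduct]
      have h4 := hA.mulVec_eigenvectorBasis i
      have hAt : Aᵀ = A := by rw [← conjTranspose_eq_transpose_of_trivial]; exact hA
      simp only [star_trivial]
      rw [dotProduct_comm, dotProduct_mulVec, ← mulVec_transpose, hAt]
      rw [show A *ᵥ (b i).ofLp = _ from h4]
      simp [b]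
    rw [h2, h3]; ring
  have hQx := hQ x
  rw [← hz, hE, hnorm, Finset.mul_sum] at hQx
  have hzero : ∀ i, ¬ hA.eigenvalues i < θ → b.repr Z i = 0 := by
    intro i hi
    rw [hc]
    exact congrFun hxF ⟨i, hi⟩
  have hZ : ∃ i, b.repr Z i ≠ 0 := by
    by_contra! h
    apply hx0
    apply hT
    have : ∑ i, (z i)^2 = 0 := by rw [hnorm]; simp [h]
    rw [Finset.sum_eq_zero_iff_of_nonneg (fun i _ => sq_nonneg _)] at this
    ext i
    simpa using this i (Finset.mem_univ i)
  have : ∑ i, hA.eigenvalues i * (b.repr Z i)^2 < ∑ i, θ * (b.repr Z i)^2 := by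
    obtain ⟨i, hi⟩ := hZ
    refine Finset.sum_lt_sum (fun j _ => ?_) ⟨i, Finset.mem_univ i, ?_⟩
    · by_cases hj : hA.eigenvalues j < θ
      · exact mul_le_mul_of_nonneg_right hj.le (sq_nonneg _)
      · simp [hzero j hj]
    · have : hA.eigenvalues i < θ := by
        by_contra h; exact hi (hzero i h)
      exact mul_lt_mul_of_pos_right this (by positivity)
  linarith

lemma three_of_degrees {n : ℕ} (hn : 3 ≤ n) (d f : Fin n → ℕ) (hd : Monotone d)
    (h : Finset.univ.val.map d = Finset.univ.val.map f) :
    ∃ a b c : Fin n, a ≠ b ∧ a ≠ c ∧ b ≠ c ∧ d ⟨n - 3, idx_lt hn⟩ ≤ f a ∧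
      d ⟨n - 3, idx_lt hn⟩ ≤ f b ∧ d ⟨n - 3, idx_lt hn⟩ ≤ f c := by
  set D := d ⟨n - 3, idx_lt hn⟩ with hD
  have hcount : #{i | D ≤ d i} = #{i | D ≤ f i} := by
    have := congrArg (Multiset.countP (fun t => D ≤ t)) h
    rw [Multiset.countP_map, Multiset.countP_map] at this
    exact this
  have hge : 3 ≤ #{i | D ≤ d i} := by
    have : (Finset.Ici (⟨n - 3, idx_lt hn⟩ : Fin n)) ⊆ ({i | D ≤ d i} : Finset (Fin n)) := by
      intro i hi
      simp only [Finset.mem_Ici] at hi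
      simp only [Finset.mem_filter, Finset.mem_univ, true_and]
      exact hd hi
    have h2 := Finset.card_le_card this
    rw [Fin.card_Ici] at h2
    simp only at h2
    omega
  rw [hcount] at hge
  obtain ⟨a, b, c, ha, hb, hc, h1, h2, h3⟩ := Finset.two_lt_card_iff.1 (show 2 < _ from hge)
  simp only [Finset.mem_filter, Finset.mem_univ, true_and] at ha hb hc
  exact ⟨a, b, c, h1, h2, h3, ha, hb, hc⟩

def rest3 {n : ℕ} (a b c : Fin n) : Finset (Fin n) := Finset.univ.filter (fun w => w ≠ a ∧ w ≠ b ∧ w ≠ c)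

lemma sum_split3 {n : ℕ} {a b c : Fin n} (hab : a ≠ b) (hac : a ≠ c) (hbc : b ≠ c) (f : Fin n → ℝ) :
    ∑ i, f i = f a + f b + f c + ∑ w ∈ rest3 a b c, f w := by
  rw [← Finset.sum_add_sum_compl ({a, b, c} : Finset (Fin n))]
  have : ({a, b, c} : Finset (Fin n))ᶜ = rest3 a b c := by
    ext w; simp [rest3]
  rw [this, Finset.sum_insert (by simp [hab, hac]), Finset.sum_insert (by simp [hbc]), Finset.sum_singleton]
  ring

def ad {n : ℕ} (G : SimpleGraph (Fin n)) [DecidableRel G.Adj] (i j : Fin n) : ℝ := if G.Adj i j then 1 else 0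

section
variable {n : ℕ} (G : SimpleGraph (Fin n)) [DecidableRel G.Adj]

lemma ad_comm (i j : Fin n) : ad G i j = ad G j i := by simp [ad, G.adj_comm]
lemma ad_self (i : Fin n) : ad G i i = 0 := by simp [ad]
lemma ad_cases (i j : Fin n) : ad G i j = 0 ∨ ad G i j = 1 := by
  unfold ad; split_ifs <;> simp
lemma ad_nonneg (i j : Fin n) : 0 ≤ ad G i j := by
  rcases ad_cases G i j with h | h <;> simp [h]

lemma deg_split {a b c : Fin n} (hab : a ≠ b) (hac : a ≠ c) (hbc : b ≠ c) (v : Fin n) :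
    (G.degree v : ℝ) = ad G v a + ad G v b + ad G v c + ∑ w ∈ rest3 a b c, ad G v w := by
  rw [← sum_split3 hab hac hbc (fun w => ad G v w)]
  rw [← G.card_neighborFinset_eq_degree, G.neighborFinset_eq_filter]
  simp [ad]

lemma energy_ge {a b c : Fin n} (hab : a ≠ b) (hac : a ≠ c) (hbc : b ≠ c) (z : Fin n → ℝ) :
    ad G a b * (z a - z b)^2 + ad G a c * (z a - z c)^2 + ad G b c * (z b - z c)^2 +
      ∑ w ∈ rest3 a b c, (ad G a w * (z a - z w)^2 + ad G b w * (z b - z w)^2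
        + ad G c w * (z c - z w)^2) ≤ z ⬝ᵥ (G.lapMatrix ℝ) *ᵥ z := by
  have h := G.lapMatrix_toLinearMap₂' ℝ z
  rw [Matrix.toLinearMap₂'_apply'] at h
  rw [h]
  have h2 : ∀ i j, (if G.Adj i j then (z i - z j)^2 else 0) = ad G i j * (z i - z j)^2 := by
    intro i j; simp [ad]
  simp_rw [h2]
  rw [sum_split3 hab hac hbc]
  have h3 : ∑ w ∈ rest3 a b c, (ad G a w * (z a - z w)^2 + ad G b w * (z b - z w)^2
        + ad G c w * (z c - z w)^2) ≤ ∑ w ∈ rest3 a b c, ∑ j, ad G w j * (z w - z j)^2 := by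
    refine Finset.sum_le_sum fun w _ => ?_
    rw [sum_split3 hab hac hbc]
    have : 0 ≤ ∑ v ∈ rest3 a b c, ad G w v * (z w - z v)^2 :=
      Finset.sum_nonneg fun v _ => mul_nonneg (ad_nonneg G _ _) (sq_nonneg _)
    rw [ad_comm G a w, ad_comm G b w, ad_comm G c w]
    nlinarith
  rw [sum_split3 hab hac hbc (fun j => ad G a j * (z a - z j)^2),
    sum_split3 hab hac hbc (fun j => ad G b j * (z b - z j)^2),
    sum_split3 hab hac hbc (fun j => ad G c j * (z c - z j)^2)]
  simp only [Finset.sum_add_distrib] at h3 ⊢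
  rw [ad_comm G b a, ad_comm G c a, ad_comm G c b, ad_self, ad_self, ad_self]
  nlinarith
end

lemma dom3 {A B C p q r : ℝ} (h1 : |p| + |q| ≤ A) (h2 : |p| + |r| ≤ B) (h3 : |q| + |r| ≤ C) (x y z : ℝ) :
    0 ≤ A*x^2 + B*y^2 + C*z^2 + 2*p*x*y + 2*q*x*z + 2*r*y*z := by
  have key : ∀ p x y : ℝ, 0 ≤ |p| * x^2 + |p| * y^2 + 2*p*x*y := by
    intro p x y
    rcases abs_cases p with ⟨h, h'⟩ | ⟨h, h'⟩ <;> rw [h]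
    · nlinarith [mul_nonneg h' (sq_nonneg (x+y))]
    · nlinarith [mul_nonneg (neg_nonneg.2 h'.le) (sq_nonneg (x-y))]
  nlinarith [key p x y, key q x z, key r y z, mul_nonneg (sub_nonneg.2 h1) (sq_nonneg x),
   mul_nonneg (sub_nonneg.2 h2) (sq_nonneg y), mul_nonneg (sub_nonneg.2 h3) (sq_nonneg z)]

section
variable {n : ℕ} (G : SimpleGraph (Fin n)) [DecidableRel G.Adj]

lemma core (hn : 3 ≤ n)
    (eigs : Fin n → ℝ) (heigs : Monotone eigs)
    (hroots : (G.lapMatrix ℝ).charpoly.roots = Finset.univ.val.map eigs) (θ : ℝ)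
    {a b c : Fin n} (hab : a ≠ b) (hac : a ≠ c) (hbc : b ≠ c) (p q r : Fin n → ℝ)
    (H : ∀ x y z : ℝ, 0 ≤ ad G a b * (x - y)^2 + ad G a c * (x - z)^2 + ad G b c * (y - z)^2
      - θ * (x^2 + y^2 + z^2) + ∑ w ∈ rest3 a b c, (ad G a w * (x - (p w * x + q w * y + r w * z))^2
        + ad G b w * (y - (p w * x + q w * y + r w * z))^2
        + ad G c w * (z - (p w * x + q w * y + r w * z))^2
        - θ * (p w * x + q w * y + r w * z)^2)) :
    θ ≤ eigs ⟨n - 3, idx_lt hn⟩ := by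
  let T : (Fin 3 → ℝ) →ₗ[ℝ] (Fin n → ℝ) :=
    { toFun := fun x v => if v = a then x 0 else if v = b then x 1 else if v = c then x 2 else
        p v * x 0 + q v * x 1 + r v * x 2
      map_add' := by
        intro x y; ext v; simp only [Pi.add_apply]; split_ifs <;> ring
      map_smul' := by
        intro t x; ext v; simp only [Pi.smul_apply, smul_eq_mul, RingHom.id_apply]
        split_ifs <;> ring }
  have Ta : ∀ x, T x a = x 0 := fun x => by simp [T]
  have Tb : ∀ x, T x b = x 1 := fun x => by simp [T, hab.symm]
  have Tc : ∀ x, T x c = x 2 := fun x => by simp [T, hac.symm, hbc.symm]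
  have Tw : ∀ x, ∀ w ∈ rest3 a b c, T x w = p w * x 0 + q w * x 1 + r w * x 2 := fun x w hw => by
    simp only [rest3, Finset.mem_filter, Finset.mem_univ, true_and] at hw
    simp [T, hw.1, hw.2.1, hw.2.2]
  refine minmax3 hn _ (G.isHermitian_lapMatrix ℝ) eigs heigs hroots θ T ?_ ?_
  · intro x hx
    ext i
    fin_cases i
    · simpa [Ta] using congrFun hx a
    · simpa [Tb] using congrFun hx b
    · simpa [Tc] using congrFun hx c
  · intro x
    refine le_trans ?_ (energy_ge G hab hac hbc (T x))
    rw [sum_split3 hab hac hbc, Ta, Tb, Tc]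
    have h := H (x 0) (x 1) (x 2)
    have e1 : ∑ w ∈ rest3 a b c, (T x w)^2 =
        ∑ w ∈ rest3 a b c, (p w * x 0 + q w * x 1 + r w * x 2)^2 :=
      Finset.sum_congr rfl fun w hw => by rw [Tw x w hw]
    have e2 : ∑ w ∈ rest3 a b c, (ad G a w * (x 0 - T x w)^2 + ad G b w * (x 1 - T x w)^2
        + ad G c w * (x 2 - T x w)^2) =
        ∑ w ∈ rest3 a b c, (ad G a w * (x 0 - (p w * x 0 + q w * x 1 + r w * x 2))^2
          + ad G b w * (x 1 - (p w * x 0 + q w * x 1 + r w * x 2))^2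
        + ad G c w * (x 2 - (p w * x 0 + q w * x 1 + r w * x 2))^2) :=
      Finset.sum_congr rfl fun w hw => by rw [Tw x w hw]
    rw [e1, e2]
    rw [Finset.sum_sub_distrib, ← Finset.mul_sum] at h
    linarith

lemma core0 (hn : 3 ≤ n)
    (eigs : Fin n → ℝ) (heigs : Monotone eigs)
    (hroots : (G.lapMatrix ℝ).charpoly.roots = Finset.univ.val.map eigs) (θ : ℝ)
    {a b c : Fin n} (hab : a ≠ b) (hac : a ≠ c) (hbc : b ≠ c)
    (h1 : ad G a b + ad G a c ≤ G.degree a - θ)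
    (h2 : ad G a b + ad G b c ≤ G.degree b - θ)
    (h3 : ad G a c + ad G b c ≤ G.degree c - θ) :
    θ ≤ eigs ⟨n - 3, idx_lt hn⟩ := by
  refine core G hn eigs heigs hroots θ hab hac hbc 0 0 0 ?_
  intro x y z
  have da := deg_split G hab hac hbc a
  have db := deg_split G hab hac hbc b
  have dc := deg_split G hab hac hbc c
  rw [ad_self] at da db dc
  rw [ad_comm G b a] at db
  rw [ad_comm G c a, ad_comm G c b] at dc
  have hd := @dom3 (G.degree a - θ) (G.degree b - θ) (G.degree c - θ) (-ad G a b) (-ad G a c) (-ad G b c)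
    (by simpa [abs_of_nonneg, ad_nonneg] using h1) (by simpa [abs_of_nonneg, ad_nonneg] using h2)
    (by simpa [abs_of_nonneg, ad_nonneg] using h3) x y z
  simp only [Pi.zero_apply, zero_mul, add_zero, sub_zero, Finset.sum_add_distrib, ← Finset.sum_mul,
    ne_eq, OfNat.ofNat_ne_zero, not_false_eq_true, zero_pow, mul_zero]
  rw [da, db, dc] at hd
  linarith

lemma case_big (hn : 3 ≤ n)
    (eigs : Fin n → ℝ) (heigs : Monotone eigs)
    (hroots : (G.lapMatrix ℝ).charpoly.roots = Finset.univ.val.map eigs) (e : ℝ) (he : 1 ≤ e)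
    {a b c : Fin n} (hab : a ≠ b) (hac : a ≠ c) (hbc : b ≠ c)
    (jab : ad G a b = 1) (jbc : ad G b c = 1)
    (h1 : e + 2 ≤ G.degree a) (h2 : e + 2 ≤ G.degree b) (h3 : e + 2 ≤ G.degree c) :
    e + 1 ≤ eigs ⟨n - 3, idx_lt hn⟩ := by
  have he0 : 0 < e := by linarith
  refine core G hn eigs heigs hroots (e+1) hab hac hbc (fun w => -ad G a w / e)
    (fun w => -ad G b w / e) (fun w => -ad G c w / e) ?_
  intro x y z
  have da := deg_split G hab hac hbc a
  have db := deg_split G hab hac hbc b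
  have dc := deg_split G hab hac hbc c
  rw [ad_self] at da db dc
  rw [ad_comm G b a] at db
  rw [ad_comm G c a, ad_comm G c b] at dc
  have hsum : ∑ w ∈ rest3 a b c, ((1 + 1/e) * (ad G a w * x^2 + ad G b w * y^2 + ad G c w * z^2)
      + (2 / e) * (ad G a w * ad G b w * (x*y) + ad G a w * ad G c w * (x*z)
        + ad G b w * ad G c w * (y*z))) ≤
      ∑ w ∈ rest3 a b c, (ad G a w * (x - (-ad G a w / e * x + -ad G b w / e * y + -ad G c w / e * z))^2
        + ad G b w * (y - (-ad G a w / e * x + -ad G b w / e * y + -ad G c w / e * z))^2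
        + ad G c w * (z - (-ad G a w / e * x + -ad G b w / e * y + -ad G c w / e * z))^2
        - (e+1) * (-ad G a w / e * x + -ad G b w / e * y + -ad G c w / e * z)^2) := by
    refine Finset.sum_le_sum fun w _ => ?_
    rw [← sub_nonneg]
    have key : ∀ α β γ : ℝ, (α = 0 ∨ α = 1) → (β = 0 ∨ β = 1) → (γ = 0 ∨ γ = 1) →
      (α * (x - (-α / e * x + -β / e * y + -γ / e * z))^2
        + β * (y - (-α / e * x + -β / e * y + -γ / e * z))^2
        + γ * (z - (-α / e * x + -β / e * y + -γ / e * z))^2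
        - (e+1) * (-α / e * x + -β / e * y + -γ / e * z)^2) -
       ((1 + 1/e) * (α * x^2 + β * y^2 + γ * z^2)
      + (2 / e) * (α * β * (x*y) + α * γ * (x*z) + β * γ * (y*z)))
       = (if α = 0 ∧ β = 0 ∧ γ = 0 then 0 else (α + β + γ - 1)) * (α * x + β * y + γ * z)^2 / e^2 := by
      rintro α β γ (rfl | rfl) (rfl | rfl) (rfl | rfl) <;> simp <;> field_simp <;> ring
    rw [key _ _ _ (ad_cases G a w) (ad_cases G b w) (ad_cases G c w)]
    apply div_nonneg _ (sq_nonneg _)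
    apply mul_nonneg _ (sq_nonneg _)
    rcases ad_cases G a w with h | h <;> rcases ad_cases G b w with h' | h' <;>
      rcases ad_cases G c w with h'' | h'' <;> norm_num [h, h', h'']
  refine le_trans ?_ (add_le_add_right hsum _)
  simp only [Finset.sum_add_distrib, ← Finset.sum_mul, ← Finset.mul_sum]
  have cle : ∀ u v : Fin n, ∑ w ∈ rest3 a b c, ad G u w * ad G v w ≤ ∑ w ∈ rest3 a b c, ad G u w ∧
      ∑ w ∈ rest3 a b c, ad G u w * ad G v w ≤ ∑ w ∈ rest3 a b c, ad G v w ∧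
      0 ≤ ∑ w ∈ rest3 a b c, ad G u w * ad G v w := by
    intro u v
    refine ⟨Finset.sum_le_sum fun w _ => ?_, Finset.sum_le_sum fun w _ => ?_,
      Finset.sum_nonneg fun w _ => ?_⟩ <;>
    rcases ad_cases G u w with h | h <;> rcases ad_cases G v w with h' | h' <;> norm_num [h, h']
  obtain ⟨c1, c2, c3⟩ := cle a b
  obtain ⟨c4, c5, c6⟩ := cle a c
  obtain ⟨c7, c8, c9⟩ := cle b c
  rw [da] at h1
  rw [db] at h2
  rw [dc] at h3
  clear hsum cle da db dc
  generalize ∑ w ∈ rest3 a b c, ad G a w * ad G b w = cab at *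
  generalize ∑ w ∈ rest3 a b c, ad G a w * ad G c w = cac at *
  generalize ∑ w ∈ rest3 a b c, ad G b w * ad G c w = cbc at *
  generalize ∑ w ∈ rest3 a b c, ad G a w = oa at *
  generalize ∑ w ∈ rest3 a b c, ad G b w = ob at *
  generalize ∑ w ∈ rest3 a b c, ad G c w = oc at *
  rw [jab, jbc] at *
  have hs := ad_cases G a c
  generalize ad G a c = s at *
  -- reduce to unit scale
  have hdiv : ∀ t : ℝ, 0 ≤ t → t / e ≤ t := fun t ht => div_le_self ht he
  have hadj : ∀ t o : ℝ, 0 ≤ t → t ≤ o → e ≤ o → |-1 + t / e| ≤ 1 ∨ |-1 + t/e| ≤ (o - e)/e := by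
    intro t o h0 h1 h2
    have : 0 ≤ t / e := by positivity
    have h3 : t / e ≤ o / e := by gcongr
    have h4 : (o - e)/e = o/e - 1 := by field_simp
    rcases abs_cases (-1 + t/e) with ⟨h, _⟩ | ⟨h, _⟩
    · right; linarith
    · left; linarith
  have hoe : ∀ o : ℝ, o / e = 1 + (o - e)/e := by intro o; field_simp; ring
  have hs0 : 0 ≤ s := by rcases hs with rfl | rfl <;> norm_num
  have hs1 : s ≤ 1 := by rcases hs with rfl | rfl <;> norm_num
  have ea : e ≤ oa := by linarith
  have eb : e ≤ ob := by linarith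
  have ec : e ≤ oc := by linarith
  have fa := hdiv (oa - e) (by linarith)
  have fb := hdiv (ob - e) (by linarith)
  have fc := hdiv (oc - e) (by linarith)
  have fa0 : 0 ≤ (oa - e)/e := div_nonneg (by linarith) he0.le
  have fb0 : 0 ≤ (ob - e)/e := div_nonneg (by linarith) he0.le
  have fc0 : 0 ≤ (oc - e)/e := div_nonneg (by linarith) he0.le
  have A1 := hadj cab oa c3 c1 ea
  have A2 := hadj cab ob c3 c2 eb
  have B1 := hadj cbc ob c9 c7 eb
  have B2 := hadj cbc oc c9 c8 ec
  have hd := @dom3 (1 + s - (e+1) + oa + oa/e) (2 - (e+1) + ob + ob/e) (1 + s - (e+1) + oc + oc/e)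
    (-1 + cab/e) (-s + cac/e) (-1 + cbc/e) ?_ ?_ ?_ x y z
  · refine hd.trans (le_of_eq ?_)
    field_simp
    ring
  · rw [hoe oa]
    rcases hs with rfl | rfl
    · rw [neg_zero, zero_add, abs_of_nonneg (div_nonneg c6 he0.le)]
      have : cac / e ≤ oa / e := by gcongr
      rw [hoe oa] at this
      rcases A1 with A1 | A1 <;> linarith
    · have C1 := hadj cac oa c6 c4 ea
      rcases A1 with A1 | A1 <;> rcases C1 with C1 | C1 <;> linarith
  · rw [hoe ob]
    rcases A2 with A1 | A1 <;> rcases B1 with C1 | C1 <;> linarith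
  · rw [hoe oc]
    rcases hs with rfl | rfl
    · rw [neg_zero, zero_add, abs_of_nonneg (div_nonneg c6 he0.le)]
      have : cac / e ≤ oc / e := by gcongr
      rw [hoe oc] at this
      rcases B2 with A1 | A1 <;> linarith
    · have C1 := hadj cac oc c6 c5 ec
      rcases B2 with A1 | A1 <;> rcases C1 with C1 | C1 <;> linarith
end

section
variable {n : ℕ} (G : SimpleGraph (Fin n)) [DecidableRel G.Adj]

lemma case_path (hn : 3 ≤ n)
    (eigs : Fin n → ℝ) (heigs : Monotone eigs)
    (hroots : (G.lapMatrix ℝ).charpoly.roots = Finset.univ.val.map eigs)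
    {a b c : Fin n} (hab : a ≠ b) (hac : a ≠ c) (hbc : b ≠ c)
    (jab : ad G a b = 1) (jbc : ad G b c = 1) (jac : ad G a c = 0)
    (h1 : (2 : ℝ) ≤ G.degree a) (h3 : (2 : ℝ) ≤ G.degree c) :
    1 ≤ eigs ⟨n - 3, idx_lt hn⟩ := by
  have da := deg_split G hab hac hbc a
  have db := deg_split G hab hac hbc b
  have dc := deg_split G hab hac hbc c
  rw [ad_self] at da db dc
  rw [ad_comm G b a] at db
  rw [ad_comm G c a, ad_comm G c b] at dc
  by_cases hb : ∃ w ∈ rest3 a b c, ad G b w = 1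
  · obtain ⟨w, hw, hw1⟩ := hb
    have : ad G b w ≤ ∑ w ∈ rest3 a b c, ad G b w :=
      Finset.single_le_sum (f := fun w => ad G b w) (fun i _ => ad_nonneg G b i) hw
    refine core0 G hn eigs heigs hroots 1 hab hac hbc ?_ ?_ ?_ <;> linarith
  · push Not at hb
    have hb0 : ∀ w ∈ rest3 a b c, ad G b w = 0 := fun w hw => (ad_cases G b w).resolve_right (hb w hw)
    refine core G hn eigs heigs hroots 1 hab hac hbc (fun w => -ad G a w) 0 (fun w => -ad G c w) ?_
    intro x y z
    have hsum : ∑ w ∈ rest3 a b c, (3 * (ad G a w * x^2 + ad G c w * z^2)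
        + 4 * (ad G a w * ad G c w * (x*z))) ≤
      ∑ w ∈ rest3 a b c, (ad G a w * (x - (-ad G a w * x + (0 : Fin n → ℝ) w * y + -ad G c w * z))^2
        + ad G b w * (y - (-ad G a w * x + (0 : Fin n → ℝ) w * y + -ad G c w * z))^2
        + ad G c w * (z - (-ad G a w * x + (0 : Fin n → ℝ) w * y + -ad G c w * z))^2
        - 1 * (-ad G a w * x + (0 : Fin n → ℝ) w * y + -ad G c w * z)^2) := by
      refine Finset.sum_le_sum fun w hw => ?_
      rw [hb0 w hw, Pi.zero_apply]
      rcases ad_cases G a w with h | h <;> rcases ad_cases G c w with h' | h' <;> rw [h, h'] <;>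
        nlinarith [sq_nonneg (x+z)]
    refine le_trans ?_ (add_le_add_right hsum _)
    simp only [Finset.sum_add_distrib, ← Finset.sum_mul, ← Finset.mul_sum]
    have c1 : ∑ w ∈ rest3 a b c, ad G a w * ad G c w ≤ ∑ w ∈ rest3 a b c, ad G a w :=
      Finset.sum_le_sum fun w _ => by
        rcases ad_cases G a w with h | h <;> rcases ad_cases G c w with h' | h' <;> norm_num [h, h']
    have c2 : ∑ w ∈ rest3 a b c, ad G a w * ad G c w ≤ ∑ w ∈ rest3 a b c, ad G c w :=
      Finset.sum_le_sum fun w _ => by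
        rcases ad_cases G a w with h | h <;> rcases ad_cases G c w with h' | h' <;> norm_num [h, h']
    have c3 : 0 ≤ ∑ w ∈ rest3 a b c, ad G a w * ad G c w :=
      Finset.sum_nonneg fun w _ => mul_nonneg (ad_nonneg _ _ _) (ad_nonneg _ _ _)
    rw [da] at h1
    rw [dc] at h3
    clear hsum da db dc
    generalize ∑ w ∈ rest3 a b c, ad G a w * ad G c w = cac at *
    generalize ∑ w ∈ rest3 a b c, ad G a w = oa at *
    generalize ∑ w ∈ rest3 a b c, ad G c w = oc at *
    rw [jab, jbc, jac] at *
    have hA : |2 * cac - 1| + |0| ≤ 3 * oa - 1 := by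
      rw [abs_zero]; rcases abs_cases (2 * cac - 1) with ⟨h, _⟩ | ⟨h, _⟩ <;> linarith
    have hB : |2 * cac - 1| + |0| ≤ 3 * oc - 1 := by
      rw [abs_zero]; rcases abs_cases (2 * cac - 1) with ⟨h, _⟩ | ⟨h, _⟩ <;> linarith
    have hd := dom3 hA hB (C := 0) (by simp) x z 0
    nlinarith [sq_nonneg (y - (x + z))]

lemma case_tri (hn : 3 ≤ n)
    (eigs : Fin n → ℝ) (heigs : Monotone eigs)
    (hroots : (G.lapMatrix ℝ).charpoly.roots = Finset.univ.val.map eigs)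
    {a b c : Fin n} (hab : a ≠ b) (hac : a ≠ c) (hbc : b ≠ c)
    (jab : ad G a b = 1) (jbc : ad G b c = 1) (jac : ad G a c = 1)
    (w0 : Fin n) (hw0 : w0 ∈ rest3 a b c) (ja : ad G a w0 = 1) :
    1 ≤ eigs ⟨n - 3, idx_lt hn⟩ := by
  let p : Fin n → ℝ := fun w => if w = w0 then -1 else 0
  refine core G hn eigs heigs hroots 1 hab hac hbc p p p ?_
  intro x y z
  have hsum : ∑ w ∈ rest3 a b c, (ad G a w * (x - (p w * x + p w * y + p w * z))^2
        + ad G b w * (y - (p w * x + p w * y + p w * z))^2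
        + ad G c w * (z - (p w * x + p w * y + p w * z))^2
        - 1 * (p w * x + p w * y + p w * z)^2) =
      ∑ w ∈ rest3 a b c, ((ad G a w * x^2 + ad G b w * y^2 + ad G c w * z^2) + if w = w0 then
        (ad G a w0 * ((x + (x+y+z))^2 - x^2) + ad G b w0 * ((y + (x+y+z))^2 - y^2)
          + ad G c w0 * ((z + (x+y+z))^2 - z^2) - (x+y+z)^2) else 0) := by
    refine Finset.sum_congr rfl fun w _ => ?_
    by_cases h : w = w0
    · subst h; simp only [p, if_true]; ring
    · simp only [p, if_neg h]; ring
  rw [hsum, Finset.sum_add_distrib, Finset.sum_ite_eq' , if_pos hw0]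
  simp only [Finset.sum_add_distrib, ← Finset.sum_mul]
  have s : ∀ v, ad G v w0 ≤ ∑ w ∈ rest3 a b c, ad G v w := fun v =>
      Finset.single_le_sum (f := fun w => ad G v w) (fun i _ => ad_nonneg G v i) hw0
  have sa := mul_le_mul_of_nonneg_right (s a) (sq_nonneg x)
  have sb := mul_le_mul_of_nonneg_right (s b) (sq_nonneg y)
  have sc := mul_le_mul_of_nonneg_right (s c) (sq_nonneg z)
  rw [ja] at sa ⊢
  rw [jab, jac, jbc]
  rcases ad_cases G b w0 with h | h <;> rcases ad_cases G c w0 with h' | h' <;> rw [h] at sb ⊢ <;>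
    rw [h'] at sc ⊢
  · nlinarith [sq_nonneg (y - z), sq_nonneg x]
  · have := @dom3 5 2 5 1 2 1 (by norm_num) (by norm_num) (by norm_num) x y z
    nlinarith
  · have := @dom3 5 5 2 2 1 1 (by norm_num) (by norm_num) (by norm_num) x y z
    nlinarith
  · have := @dom3 6 6 6 3 3 3 (by norm_num) (by norm_num) (by norm_num) x y z
    nlinarith

lemma ad_eq_one {i j : Fin n} : ad G i j = 1 ↔ G.Adj i j := by simp [ad]
lemma ad_eq_zero {i j : Fin n} : ad G i j = 0 ↔ ¬ G.Adj i j := by simp [ad]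

lemma case_center (hn : 3 ≤ n)
    (eigs : Fin n → ℝ) (heigs : Monotone eigs)
    (hroots : (G.lapMatrix ℝ).charpoly.roots = Finset.univ.val.map eigs)
    (hnot : ¬ IsCliquePlusIsolated G 3) (D : ℕ) (hD : 2 ≤ D)
    {a b c : Fin n} (hab : a ≠ b) (hac : a ≠ c) (hbc : b ≠ c)
    (jab : ad G a b = 1) (jbc : ad G b c = 1)
    (h1 : D ≤ G.degree a) (h2 : D ≤ G.degree b) (h3 : D ≤ G.degree c) :
    (D : ℝ) - 1 ≤ eigs ⟨n - 3, idx_lt hn⟩ := by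
  have h1' : (D : ℝ) ≤ G.degree a := by exact_mod_cast h1
  have h2' : (D : ℝ) ≤ G.degree b := by exact_mod_cast h2
  have h3' : (D : ℝ) ≤ G.degree c := by exact_mod_cast h3
  rcases hD.lt_or_eq with hD | rfl
  · have hD' : (3 : ℝ) ≤ D := by exact_mod_cast hD
    have := case_big G hn eigs heigs hroots (D - 2) (by linarith) hab hac hbc jab jbc
      (by linarith) (by linarith) (by linarith)
    linarith
  push_cast at h1' h2' h3'
  suffices 1 ≤ eigs ⟨n - 3, idx_lt hn⟩ by push_cast; linarith
  rcases ad_cases G a c with jac | jac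
  · exact case_path G hn eigs heigs hroots hab hac hbc jab jbc jac h1' h3'
  have mem : ∀ w, w ∈ rest3 a b c ↔ w ≠ a ∧ w ≠ b ∧ w ≠ c := fun w => by simp [rest3]
  by_cases ha : ∃ w, w ∈ rest3 a b c ∧ G.Adj a w
  · obtain ⟨w, hw, hj⟩ := ha
    exact case_tri G hn eigs heigs hroots hab hac hbc jab jbc jac w hw ((ad_eq_one G).2 hj)
  by_cases hb : ∃ w, w ∈ rest3 a b c ∧ G.Adj b w
  · obtain ⟨w, hw, hj⟩ := hb
    have hw' : w ∈ rest3 b a c := by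
      simp only [rest3, Finset.mem_filter, Finset.mem_univ, true_and] at hw ⊢; tauto
    exact case_tri G hn eigs heigs hroots hab.symm hbc hac (by rwa [ad_comm]) jac jbc w hw'
      ((ad_eq_one G).2 hj)
  by_cases hc : ∃ w, w ∈ rest3 a b c ∧ G.Adj c w
  · obtain ⟨w, hw, hj⟩ := hc
    have hw' : w ∈ rest3 c a b := by
      simp only [rest3, Finset.mem_filter, Finset.mem_univ, true_and] at hw ⊢; tauto
    exact case_tri G hn eigs heigs hroots hac.symm hbc.symm hab (by rwa [ad_comm]) jab
      (by rwa [ad_comm]) w hw' ((ad_eq_one G).2 hj)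
  push Not at ha hb hc
  have key : ∃ u v, u ∈ rest3 a b c ∧ G.Adj u v := by
    by_contra! hno
    apply hnot
    refine ⟨{a, b, c}, Finset.card_eq_three.2 ⟨a, b, c, hab, hac, hbc, rfl⟩, ?_⟩
    have hS : ∀ u v, G.Adj u v → u ∈ ({a, b, c} : Finset (Fin n)) := by
      intro u v huv
      by_contra hu
      refine hno u v ((mem u).2 ?_) huv
      simpa using hu
    intro u v
    constructor
    · intro huv
      exact ⟨huv.ne, hS u v huv, hS v u huv.symm⟩
    · rintro ⟨hne, hu, hv⟩
      rw [ad_eq_one] at jab jbc jac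
      simp only [Finset.mem_insert, Finset.mem_singleton] at hu hv
      rcases hu with rfl | rfl | rfl <;> rcases hv with rfl | rfl | rfl <;>
        first | exact absurd rfl hne | assumption | (apply SimpleGraph.Adj.symm; assumption)
  obtain ⟨u, v, hu, huv⟩ := key
  have hu' := (mem u).1 hu
  have hdu : (1 : ℝ) ≤ G.degree u := by
    have : 0 < G.degree u := (G.degree_pos_iff_exists_adj u).2 ⟨v, huv⟩
    exact_mod_cast this
  have z1 : ad G a u = 0 := (ad_eq_zero G).2 (ha u hu)
  have z2 : ad G b u = 0 := (ad_eq_zero G).2 (hb u hu)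
  refine core0 G hn eigs heigs hroots 1 hab hu'.1.symm hu'.2.1.symm ?_ ?_ ?_ <;> linarith
end

/-- Guo: if `G ≠ K_3 + (n-3)K_1`, then `λ_{n-2}(G) ≥ d_{n-2}(G) - 1`. -/
theorem lap_third_largest_eigenvalue_ge (n : ℕ) (hn : 3 ≤ n)
    (G : SimpleGraph (Fin n)) [DecidableRel G.Adj]
    (eigs : Fin n → ℝ) (heigs : Monotone eigs)
    (hroots : (G.lapMatrix ℝ).charpoly.roots = Finset.univ.val.map eigs)
    (d : Fin n → ℕ) (hd : Monotone d)
    (hdeg : Finset.univ.val.map d = Finset.univ.val.map (fun v => G.degree v))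
    (hnot : ¬ IsCliquePlusIsolated G 3) :
    eigs ⟨n - 3, by omega⟩ ≥ (d ⟨n - 3, by omega⟩ : ℝ) - 1 := by
  obtain ⟨a, b, c, hab, hac, hbc, h1, h2, h3⟩ := three_of_degrees hn d _ hd hdeg
  generalize d ⟨n - 3, by omega⟩ = D at *
  rw [ge_iff_le]
  have h1' : (D : ℝ) ≤ G.degree a := by exact_mod_cast h1
  have h2' : (D : ℝ) ≤ G.degree b := by exact_mod_cast h2
  have h3' : (D : ℝ) ≤ G.degree c := by exact_mod_cast h3
  by_cases hD : D ≤ 1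
  · have hD' : (D : ℝ) ≤ 1 := by exact_mod_cast hD
    have da := deg_split G hab hac hbc a
    have db := deg_split G hab hac hbc b
    have dc := deg_split G hab hac hbc c
    rw [ad_self] at da db dc
    rw [ad_comm G b a] at db
    rw [ad_comm G c a, ad_comm G c b] at dc
    have s : ∀ v, 0 ≤ ∑ w ∈ rest3 a b c, ad G v w := fun v =>
      Finset.sum_nonneg fun w _ => ad_nonneg G v w
    have sa := s a
    have sb := s b
    have sc := s c
    refine core0 G hn eigs heigs hroots _ hab hac hbc ?_ ?_ ?_ <;> linarith
  have hD2 : 2 ≤ D := by omega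
  rcases ad_cases G a b with jab | jab <;> rcases ad_cases G a c with jac | jac <;>
    rcases ad_cases G b c with jbc | jbc
  case inr.inl.inr | inr.inr.inr =>
    exact case_center G hn eigs heigs hroots hnot D hD2 hab hac hbc jab jbc h1 h2 h3
  case inr.inr.inl =>
    exact case_center G hn eigs heigs hroots hnot D hD2 hab.symm hbc hac (by rwa [ad_comm]) jac h2 h1 h3
  case inl.inr.inr =>
    exact case_center G hn eigs heigs hroots hnot D hD2 hac hab hbc.symm jac (by rwa [ad_comm]) h1 h3 h2
  all_goals refine core0 G hn eigs heigs hroots _ hab hac hbc ?_ ?_ ?_ <;> linarith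
end
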